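/- Let ρ, u : ℝ × ℝ → ℝ be continuously differentiable functions (of (x,t)) satisfying the conservation-of-mass equation ∂ρ/∂t + ∂(ρu)/∂x = 0 at every point, and let x* : ℝ → ℝ be a differentiable function satisfying x*(0) = 0 and dx*/dt = u(x*(t), t) for all t. Define y(x,t) := ∫_{x*(t)}^{x} ρ(z,t) dz. Then for all (x,t): (i) ∂y/∂x (x,t) = ρ(x,t), and (ii) ∂y/∂t (x,t) = −ρ(x,t) u(x,t). -/

import Mathlib

open Filter

lemma hasDerivAt_mul_of_zero (k H : ℝ → ℝ) (t k' : ℝ) (hk : HasDerivAt k k' t) (h0 : k t = 0)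
    (hH : ContinuousAt H t) : HasDerivAt (fun s => k s * H s) (k' * H t) t := by
  rw [hasDerivAt_iff_tendsto_slope] at hk ⊢
  have h := hk.mul (hH.tendsto.mono_left (nhdsWithin_le_nhds (s := {t}ᶜ)))
  refine h.congr fun s => ?_
  simp only [slope_def_field, h0]
  ring

lemma hasDerivAt_snd_fderiv (ρ : ℝ × ℝ → ℝ) (hρ : ContDiff ℝ 1 ρ) (x t : ℝ) :
    HasDerivAt (fun s => ρ (x, s)) (fderiv ℝ ρ (x, t) (0, 1)) t := by
  have h := ((hρ.differentiable one_ne_zero) (x, t)).hasFDerivAt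
  exact h.comp_hasDerivAt t ((hasDerivAt_const t x).prodMk (hasDerivAt_id t))

lemma hasDerivAt_fst_fderiv (ρ : ℝ × ℝ → ℝ) (hρ : ContDiff ℝ 1 ρ) (x t : ℝ) :
    HasDerivAt (fun z => ρ (z, t)) (fderiv ℝ ρ (x, t) (1, 0)) x := by
  have h := ((hρ.differentiable one_ne_zero) (x, t)).hasFDerivAt
  exact h.comp_hasDerivAt x ((hasDerivAt_id x).prodMk (hasDerivAt_const x t))

lemma hasDerivAt_fixed (ρ : ℝ × ℝ → ℝ) (hρ : ContDiff ℝ 1 ρ) (a b t : ℝ) :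
    HasDerivAt (fun s => ∫ z in a..b, ρ (z, s)) (∫ z in a..b, fderiv ℝ ρ (z, t) (0, 1)) t := by
  have hc : Continuous fun p : ℝ × ℝ => fderiv ℝ ρ p (0, 1) :=
    (hρ.continuous_fderiv one_ne_zero).clm_apply continuous_const
  have hr := hρ.continuous
  obtain ⟨C, hC⟩ := (isCompact_uIcc.prod (isCompact_Icc (a := t - 1) (b := t + 1))
    : IsCompact (Set.uIcc a b ×ˢ Set.Icc (t - 1) (t + 1))).exists_bound_of_continuousOn
    hc.continuousOn
  refine (intervalIntegral.hasDerivAt_integral_of_dominated_loc_of_deriv_le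
    (F := fun s z => ρ (z, s)) (F' := fun s z => fderiv ℝ ρ (z, s) (0, 1))
    (bound := fun _ => C) (s := Set.Icc (t - 1) (t + 1)) (Icc_mem_nhds (by linarith) (by linarith))
    ?_ ?_ ?_ ?_ ?_ ?_).2
  · refine Eventually.of_forall fun s => ?_
    exact (by fun_prop : Continuous fun z => ρ (z, s)).aestronglyMeasurable
  · exact (by fun_prop : Continuous fun z => ρ (z, t)).intervalIntegrable _ _
  · exact (hc.comp (by fun_prop : Continuous fun z : ℝ => (z, t))).aestronglyMeasurable
  · refine Eventually.of_forall fun z hz s hs => ?_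
    exact hC (z, s) ⟨Set.uIoc_subset_uIcc hz, hs⟩
  · exact intervalIntegrable_const
  · exact Eventually.of_forall fun z _ s _ => hasDerivAt_snd_fderiv ρ hρ z s

lemma hasDerivAt_moving (ρ : ℝ × ℝ → ℝ) (hr : Continuous ρ) (xs : ℝ → ℝ) (hxc : Continuous xs)
    (t v : ℝ) (hv : HasDerivAt xs v t) :
    HasDerivAt (fun s => ∫ z in (xs t)..(xs s), ρ (z, s)) (v * ρ (xs t, t)) t := by
  have hH : Continuous fun s => ∫ θ in (0:ℝ)..1, ρ ((xs s - xs t) * θ + xs t, s) := by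
    apply intervalIntegral.continuous_parametric_intervalIntegral_of_continuous'
    simp only [Function.uncurry_def]
    fun_prop
  have h := hasDerivAt_mul_of_zero (fun s => xs s - xs t) _ t v (hv.sub_const _) (by simp)
    hH.continuousAt
  convert h using 1
  · funext s
    have := intervalIntegral.mul_integral_comp_mul_add (a := 0) (b := 1)
      (f := fun z => ρ (z, s)) (xs s - xs t) (xs t)
    rw [this]
    simp
  · simp

/-- Derivatives of the Lagrangian (mass) coordinate
`y(x,t) = ∫_{x*(t)}^x ρ(z,t) dz`: one has `∂y/∂x = ρ` and `∂y/∂t = -ρu`. -/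
theorem lagrangian_coordinate_derivs
    (ρ u : ℝ × ℝ → ℝ) (hρ : ContDiff ℝ 1 ρ) (hu : ContDiff ℝ 1 u)
    (mass : ∀ x t : ℝ,
      deriv (fun s => ρ (x, s)) t + deriv (fun z => ρ (z, t) * u (z, t)) x = 0)
    (xs : ℝ → ℝ) (hxs0 : xs 0 = 0)
    (hxs : ∀ t : ℝ, HasDerivAt xs (u (xs t, t)) t)
    (y : ℝ × ℝ → ℝ)
    (hy : ∀ x t : ℝ, y (x, t) = ∫ z in (xs t)..x, ρ (z, t)) :
    ∀ x t : ℝ,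
      HasDerivAt (fun z => y (z, t)) (ρ (x, t)) x ∧
      HasDerivAt (fun s => y (x, s)) (-(ρ (x, t) * u (x, t))) t := by
  intro x t
  have hr := hρ.continuous
  have hcz : ∀ s, Continuous fun z => ρ (z, s) := fun s => by fun_prop
  have hxc : Continuous xs := continuous_iff_continuousAt.2 fun s => (hxs s).continuousAt
  simp only [hy]
  refine ⟨intervalIntegral.integral_hasDerivAt_right ((hcz t).intervalIntegrable _ _)
    ((hcz t).stronglyMeasurableAtFilter _ _) (hcz t).continuousAt, ?_⟩
  have h1 := hasDerivAt_fixed ρ hρ (xs t) x t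
  have h2 := hasDerivAt_moving ρ hr xs hxc t _ (hxs t)
  have hc : Continuous fun p : ℝ × ℝ => fderiv ℝ ρ p (0, 1) :=
    (hρ.continuous_fderiv one_ne_zero).clm_apply continuous_const
  have h3 : ∫ z in (xs t)..x, fderiv ℝ ρ (z, t) (0, 1)
      = -(ρ (x, t) * u (x, t)) - -(ρ (xs t, t) * u (xs t, t)) := by
    refine intervalIntegral.integral_eq_sub_of_hasDerivAt
      (f := fun z => -(ρ (z, t) * u (z, t))) (fun z _ => ?_)
      ((hc.comp (by fun_prop : Continuous fun z : ℝ => (z, t))).intervalIntegrable _ _)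
    have hd := ((hasDerivAt_fst_fderiv ρ hρ z t).mul
      (hasDerivAt_fst_fderiv u hu z t)).differentiableAt.hasDerivAt.neg
    have hm := mass z t
    rw [(hasDerivAt_snd_fderiv ρ hρ z t).deriv] at hm
    have he := eq_neg_of_add_eq_zero_left hm
    rw [he]
    exact hd
  rw [h3] at h1
  have h4 := h1.sub h2
  have e : -(ρ (x, t) * u (x, t)) - -(ρ (xs t, t) * u (xs t, t)) - u (xs t, t) * ρ (xs t, t)
      = -(ρ (x, t) * u (x, t)) := by ring
  rw [e] at h4
  refine h4.congr_of_eventuallyEq (Eventually.of_forall fun s => ?_)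
  exact (intervalIntegral.integral_interval_sub_left ((hcz s).intervalIntegrable _ _)
    ((hcz s).intervalIntegrable _ _)).symm
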